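/- arXiv:2210.06279 — 5 statements merged into one kernel-verified Lean document; each statement's English description precedes it below -/
import Mathlib

section
/- Let C be a diamond category and let G, H be objects of C. Then ∑_{F ∈ I} T_{F,H} S_{G,F} = ∑_{F ∈ I} T_{G,F} S_{F,H}, and this common value equals 1 if G ≅ H and equals 0 otherwise (both sums have only finitely many nonzero terms, since they are supported on quotients of G, respectively objects with an epimorphism to H). -/
open CategoryTheory Opposite Filter Topology MeasureTheory
open scoped ENNReal Classical

universe u

namespace MomentCat

variable {C : Type u} [SmallCategory C]

/-- The poset of isomorphism classes of quotient objects of `G`,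
realized as subobjects of `op G` in `Cᵒᵖ`.  The order is: `a ≤ b` iff `a` is a
further quotient of `b`, so that `⊤` is the class of the identity `G → G`. -/
abbrev Quotients (G : C) := Subobject (op G)

/-- The join of two quotient classes (the least upper bound, when it exists). -/
noncomputable def qSup {G : C} (a b : Quotients G) : Quotients G :=
  if h : ∃ c, IsLUB {a, b} c then h.choose else a

/-- The meet of two quotient classes (the greatest lower bound, when it exists). -/
noncomputable def qInf {G : C} (a b : Quotients G) : Quotients G :=
  if h : ∃ c, IsGLB {a, b} c then h.choose else a

/-- The join of a set of quotient classes (when it exists). -/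
noncomputable def qsSup {G : C} (s : Set (Quotients G)) : Quotients G :=
  if h : ∃ c, IsLUB s c then h.choose else ⊤

/-- The quotient class determined by an epimorphism `π : G ⟶ F`. -/
noncomputable def quotOf {G F : C} (π : G ⟶ F) (h : Epi π) : Quotients G :=
  haveI := h
  Subobject.mk π.op

/-- The underlying object of a quotient class. -/
noncomputable def qObj {G : C} (a : Quotients G) : C :=
  unop (Subobject.underlying.obj a)

/-- An object is minimal if its only quotient is itself. -/
def IsMinimalObj (G : C) : Prop := Subsingleton (Quotients G)

/-- An epimorphism is simple if it is not an isomorphism and the interval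
`[F, G]` contains only the two endpoints. -/
def IsSimpleEpi {G F : C} (π : G ⟶ F) : Prop :=
  ∃ h : Epi π, ¬IsIso π ∧ ∀ X : Quotients G, quotOf π h ≤ X → X = quotOf π h ∨ X = ⊤

/-- The interval `[a, ⊤]` is a complemented lattice. -/
def IntervalComplTop {G : C} (a : Quotients G) : Prop :=
  ∀ X : Quotients G, a ≤ X → ∃ Y : Quotients G, a ≤ Y ∧ qSup X Y = ⊤ ∧ qInf X Y = a

/-- The interval `[a, b]` is a complemented lattice. -/
def IntervalCompl {G : C} (a b : Quotients G) : Prop :=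
  ∀ X : Quotients G, a ≤ X → X ≤ b →
    ∃ Y : Quotients G, a ≤ Y ∧ Y ≤ b ∧ qSup X Y = b ∧ qInf X Y = a

/-- An epimorphism `π : G ⟶ F` is semisimple if the interval `[F,G]` is complemented. -/
def IsSemisimpleEpi {G F : C} (π : G ⟶ F) : Prop :=
  ∃ h : Epi π, IntervalComplTop (quotOf π h)

/-- A set of objects (stable under isomorphism) closed under quotients. -/
def DownwardClosed (S : Set C) : Prop :=
  ∀ G ∈ S, ∀ (F : C) (π : G ⟶ F), Epi π → F ∈ S

/-- A set of objects closed under joins of quotients of a common object. -/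
def JoinClosed (S : Set C) : Prop :=
  ∀ (G : C) (a b : Quotients G), qObj a ∈ S → qObj b ∈ S →
    (∃ c, IsLUB {a, b} c) → qObj (qSup a b) ∈ S

/-- A set of objects containing all minimal objects. -/
def MinClosed (S : Set C) : Prop := ∀ G : C, IsMinimalObj G → G ∈ S

/-- A formation: downward-closed, join-closed, containing all minimal objects. -/
def IsFormation (S : Set C) : Prop := DownwardClosed S ∧ JoinClosed S ∧ MinClosed S

/-- The smallest downward-closed join-closed set containing `B` and all minimal objects. -/
def levelGen (B : Set C) : Set C := ⋂₀ {S : Set C | IsFormation S ∧ B ⊆ S}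

/-- A level is a formation generated by a finite set of objects. -/
def IsLevel (S : Set C) : Prop := ∃ B : Set C, B.Finite ∧ S = levelGen B

/-- The type of isomorphism classes of objects of `C`. -/
abbrev IsoCls (C : Type u) [SmallCategory C] := Quotient (CategoryTheory.isIsomorphicSetoid C)

/-- The isomorphism class of an object. -/
def cls (G : C) : IsoCls C := Quotient.mk (CategoryTheory.isIsomorphicSetoid C) G

/-- The set of epimorphisms from `G` to `F`. -/
abbrev Epis (G F : C) := {π : G ⟶ F // Epi π}

/-- There is a chain of covers of length `d` from `a` to `b` (i.e. the morphism
`qObj b → qObj a` has dimension `d`). -/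
def CovChain {G : C} (a b : Quotients G) (d : ℕ) : Prop :=
  ∃ c : Fin (d + 1) → Quotients G, c 0 = a ∧ c (Fin.last d) = b ∧
    ∀ i : Fin d, c i.castSucc ⋖ c i.succ

/-- An epimorphism has dimension `d`. -/
def EpiDim {G F : C} (π : G ⟶ F) (h : Epi π) (d : ℕ) : Prop :=
  CovChain (quotOf π h) ⊤ d

/-- A set of isomorphism classes is narrow if each of its members receives simple
epimorphisms from only finitely many of its members (up to isomorphism). -/
def Narrow (S : Set C) : Prop :=
  ∀ G ∈ S, {X : IsoCls C | X.out ∈ S ∧ ∃ π : X.out ⟶ G, IsSimpleEpi π}.Finite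

/-- The minimal quotient: the bottom of the quotient poset, when it exists. -/
noncomputable def qBot (G : C) : Quotients G :=
  if h : ∃ b : Quotients G, ∀ x, b ≤ x then h.choose else ⊤

/-- `G` has complexity at most `k`: the map to the minimal quotient is a
composition of `k` semisimple epimorphisms. -/
def complexityLE (G : C) (k : ℕ) : Prop :=
  ∃ c : Fin (k + 1) → Quotients G, c 0 = qBot G ∧ c (Fin.last k) = ⊤ ∧
    ∀ i : Fin k, c i.castSucc ≤ c i.succ ∧ IntervalCompl (c i.castSucc) (c i.succ)

/-- A diamond category. -/
structure IsDiamond (C : Type u) [SmallCategory C] : Prop where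
  /-- quotient posets are finite … -/
  quotFinite : ∀ G : C, Finite (Quotients G)
  /-- … and are lattices: all pairwise joins exist … -/
  lub : ∀ (G : C) (a b : Quotients G), ∃ c, IsLUB {a, b} c
  /-- … and all pairwise meets exist … -/
  glb : ∀ (G : C) (a b : Quotients G), ∃ c, IsGLB {a, b} c
  /-- … and are modular. -/
  modular : ∀ (G : C) (a b x : Quotients G), a ≤ b →
    qSup a (qInf x b) = qInf (qSup a x) b
  /-- automorphism groups are finite -/
  autFinite : ∀ G : C, Finite (Aut G)
  /-- levels are narrow -/
  levelNarrow : ∀ S : Set C, IsLevel S → Narrow S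
  /-- countably many isomorphism classes of minimal objects -/
  minCountable : Set.Countable {X : IsoCls C | IsMinimalObj X.out}

/-- A family assigning to each object the Möbius function of its quotient poset:
`mob G x x = 1` and for `x < y`, `∑_{x ≤ z ≤ y} mob G x z = 0`. -/
def IsMobiusFamily (mob : ∀ G : C, Quotients G → Quotients G → ℝ) : Prop :=
  ∀ G : C, (∀ x : Quotients G, mob G x x = 1) ∧
    ∀ x y : Quotients G, x < y → ∑ᶠ z ∈ Set.Icc x y, mob G x z = 0

/-- `μ(π) = μ(F, G)` for an epimorphism `π : G ⟶ F`. -/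
noncomputable def muEpi (mob : ∀ G : C, Quotients G → Quotients G → ℝ)
    {G F : C} (π : G ⟶ F) (h : Epi π) : ℝ :=
  mob G (quotOf π h) ⊤

/-- `μ̂(F,G) = ∑_{π ∈ Epi(G,F)/Aut(F)} μ(π) = (∑_{π ∈ Epi(G,F)} μ(π))/|Aut F|`
(the `Aut F`-action on epimorphisms being free). -/
noncomputable def muHat (mob : ∀ G : C, Quotients G → Quotients G → ℝ) (F G : C) : ℝ :=
  (∑' π : Epis G F, muEpi mob π.1 π.2) / (Nat.card (Aut F) : ℝ)

/-- `S_{G,F} = |Epi(G,F)|/|Aut F|`. -/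
noncomputable def SQ (G F : C) : ℝ :=
  (Nat.card (Epis G F) : ℝ) / (Nat.card (Aut F) : ℝ)

/-- `T_{G,F} = μ̂(F,G)`. -/
noncomputable def TQ (mob : ∀ G : C, Quotients G → Quotients G → ℝ) (G F : C) : ℝ :=
  muHat mob F G

/-- `Z(π)`: the number of `H ∈ [F,G]` satisfying the distributive law. -/
noncomputable def Zfn {G F : C} (π : G ⟶ F) (h : Epi π) : ℕ :=
  Nat.card {H : Quotients G // quotOf π h ≤ H ∧ ∀ K₁ K₂ : Quotients G,
    quotOf π h ≤ K₁ → quotOf π h ≤ K₂ →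
      qSup H (qInf K₁ K₂) = qInf (qSup H K₁) (qSup H K₂)}

/-- The isomorphism classes lying in `W`. -/
abbrev WSub (W : Set C) := {X : IsoCls C // X.out ∈ W}

/-- `(M_G)` is well-behaved at `W`:
`∑_{G ∈ W} ∑_{π ∈ Epi(G,F)} (|μ(F,G)|/|Aut G|) Z(π)³ |M_G| < ∞` for every `F ∈ W`. -/
def WellBehavedAt (mob : ∀ G : C, Quotients G → Quotients G → ℝ) (M : IsoCls C → ℝ)
    (W : Set C) : Prop :=
  ∀ F : C, F ∈ W → Summable (fun q : Σ X : WSub W, Epis X.1.out F =>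
    |mob q.1.1.out (quotOf q.2.1 q.2.2) ⊤| / (Nat.card (Aut q.1.1.out) : ℝ)
      * ((Zfn q.2.1 q.2.2 : ℝ)) ^ 3 * |M q.1.1|)

/-- The `W`-quotient `G^W`: the join of all quotients of `G` lying in `W`. -/
noncomputable def wQuot (W : Set C) (G : C) : Quotients G :=
  qsSup {a : Quotients G | qObj a ∈ W}

/-- An epimorphism `φ : G ⟶ E` is relative-`W` if `G → G^W ∨ E` is an isomorphism. -/
def RelativeW (W : Set C) {G E : C} (φ : G ⟶ E) (h : Epi φ) : Prop :=
  qSup (wQuot W G) (quotOf φ h) = ⊤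

/-- `v_{W,F} = ∑_{G ∈ W} μ̂(F,G) M_G / |Aut G|`. -/
noncomputable def vWF (mob : ∀ G : C, Quotients G → Quotients G → ℝ) (M : IsoCls C → ℝ)
    (W : Set C) (F : C) : ℝ :=
  ∑' X : WSub W, muHat mob F X.1.out * M X.1 / (Nat.card (Aut X.1.out) : ℝ)

theorem epiComp {G F E : C} {π : G ⟶ F} {ρ : F ⟶ E} (h1 : Epi π) (h2 : Epi ρ) :
    Epi (π ≫ ρ) := by
  haveI := h1; haveI := h2; infer_instance

/-- The radical of an epimorphism with class `a`: the join of all minimal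
elements of `[a, ⊤]` distinct from `a` (together with `a` itself). -/
noncomputable def radicalEl {G : C} (a : Quotients G) : Quotients G :=
  qsSup (insert a {X : Quotients G | a ⋖ X})

end MomentCat

namespace MomentCat

section Helpers

variable {C : Type u} [SmallCategory C]

theorem quotOf_le_iff {G F E : C} (π : G ⟶ F) (h : Epi π) (σ : G ⟶ E) (h' : Epi σ) :
    quotOf π h ≤ quotOf σ h' ↔ ∃ ρ : E ⟶ F, σ ≫ ρ = π := by
  have := h; have := h'
  unfold quotOf
  constructor
  · intro hle
    refine ⟨(Subobject.ofMkLEMk _ _ hle).unop, ?_⟩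
    have := Subobject.ofMkLEMk_comp hle
    exact congrArg Quiver.Hom.unop this
  · rintro ⟨ρ, hρ⟩
    refine Subobject.mk_le_mk_of_comm ρ.op ?_
    rw [← hρ]; rfl

theorem epi_right {G F E : C} {σ : G ⟶ E} {ρ : E ⟶ F} (h : Epi (σ ≫ ρ)) : Epi ρ := by
  have := h
  exact epi_of_epi σ ρ

/-- The epimorphism onto the underlying object of a quotient class. -/
noncomputable def qArr {G : C} (x : Quotients G) : G ⟶ qObj x := x.arrow.unop

theorem epi_hom {A B : C} (e : A ≅ B) : Epi e.hom := inferInstance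

/-- Every quotient class comes from an epimorphism. -/
theorem exists_quotOf {G : C} (x : Quotients G) :
    ∃ (h : Epi (qArr x)), quotOf (qArr x) h = x := by
  refine ⟨inferInstanceAs (Epi x.arrow.unop), ?_⟩
  unfold quotOf
  exact Subobject.mk_arrow x

theorem quotOf_eq_iff {G F E : C} (π : G ⟶ F) (h : Epi π) (σ : G ⟶ E) (h' : Epi σ) :
    quotOf π h = quotOf σ h' ↔ ∃ e : E ≅ F, σ ≫ e.hom = π := by
  constructor
  · intro heq
    obtain ⟨r, hr⟩ := (quotOf_le_iff π h σ h').1 heq.le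
    obtain ⟨s, hs⟩ := (quotOf_le_iff σ h' π h).1 heq.ge
    have := h; have := h'
    refine ⟨⟨r, s, ?_, ?_⟩, hr⟩
    · rw [← cancel_epi σ, reassoc_of% hr, hs, Category.comp_id]
    · rw [← cancel_epi π, reassoc_of% hs, hr, Category.comp_id]
  · rintro ⟨e, he⟩
    apply le_antisymm
    · exact (quotOf_le_iff _ _ _ _).2 ⟨e.hom, he⟩
    · exact (quotOf_le_iff _ _ _ _).2 ⟨e.inv, by rw [← he]; simp⟩

theorem quotOf_eq_top_iff {G F : C} (π : G ⟶ F) (h : Epi π) :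
    quotOf π h = ⊤ ↔ IsIso π := by
  have h1 : (⊤ : Quotients G) = quotOf (𝟙 G) inferInstance := by
    unfold quotOf
    exact Subobject.top_eq_id _
  rw [h1, quotOf_eq_iff]
  constructor
  · rintro ⟨e, he⟩
    rw [← he]; simp; infer_instance
  · intro hi
    exact ⟨asIso π, by simp⟩

/-- Fibres of `quotOf` are torsors. -/
theorem card_fibre {G F : C} (π : Epis G F) :
    Nat.card {σ : Epis G F // quotOf σ.1 σ.2 = quotOf π.1 π.2} = Nat.card (Aut F) := by
  symm
  refine Nat.card_congr (Equiv.ofBijective (fun e : Aut F =>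
    (⟨⟨π.1 ≫ e.hom, epiComp π.2 (epi_hom e)⟩,
      (quotOf_eq_iff _ _ _ _).2 ⟨e, rfl⟩⟩ :
        {σ : Epis G F // quotOf σ.1 σ.2 = quotOf π.1 π.2})) ⟨?_, ?_⟩)
  · intro e e' he
    have he' := congrArg (fun s => s.1.1) he
    have := π.2
    apply Iso.ext
    exact (cancel_epi π.1).1 he'
  · rintro ⟨σ, hσ⟩
    obtain ⟨e, he⟩ := (quotOf_eq_iff _ _ _ _).1 hσ
    exact ⟨e, Subtype.ext (Subtype.ext he)⟩

theorem finite_fibre (hC : IsDiamond C) {G F : C} (π : Epis G F) :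
    Finite {σ : Epis G F // quotOf σ.1 σ.2 = quotOf π.1 π.2} := by
  have := hC.autFinite F
  apply Nat.finite_of_card_ne_zero
  rw [card_fibre]
  exact Nat.card_pos.ne'

theorem finite_epis (hC : IsDiamond C) (G F : C) : Finite (Epis G F) := by
  have := hC.quotFinite G
  suffices hs : ∀ x : Quotients G, Finite {π : Epis G F // quotOf π.1 π.2 = x} from
    Finite.of_equiv _ (Equiv.sigmaFiberEquiv (fun π : Epis G F => quotOf π.1 π.2))
  intro x
  by_cases hx : ∃ π : Epis G F, quotOf π.1 π.2 = x
  · obtain ⟨π, rfl⟩ := hx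
    exact finite_fibre hC π
  · push Not at hx
    have : IsEmpty {π : Epis G F // quotOf π.1 π.2 = x} := ⟨fun π => hx π.1 π.2⟩
    infer_instance

/-- A quotient class has class `X` iff it is represented by an epi to `X.out`. -/
theorem cls_eq_iff {G : C} (x : Quotients G) (X : IsoCls C) :
    cls (qObj x) = X ↔ ∃ π : Epis G X.out, quotOf π.1 π.2 = x := by
  obtain ⟨h, hx⟩ := exists_quotOf x
  constructor
  · rintro rfl
    have : IsIsomorphic (cls (qObj x)).out (qObj x) :=
      Quotient.exact (s := isIsomorphicSetoid C) (Quotient.out_eq _)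
    obtain ⟨e⟩ := this
    refine ⟨⟨qArr x ≫ e.inv, epiComp h inferInstance⟩, ?_⟩
    conv_rhs => rw [← hx]
    exact (quotOf_eq_iff _ _ _ _).2 ⟨e.symm, rfl⟩
  · rintro ⟨π, hπ⟩
    obtain ⟨e, -⟩ := (quotOf_eq_iff _ _ _ _).1 (hx.trans hπ.symm)
    have h2 : cls (qObj x) = cls X.out :=
      Quotient.sound (s := isIsomorphicSetoid C) ⟨e.symm⟩
    rw [h2]
    exact Quotient.out_eq _

/-- Sum over epis to `X.out` versus sum over quotient classes of class `X`. -/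
theorem sum_epis (hC : IsDiamond C) (G : C) (X : IsoCls C) [Fintype (Quotients G)]
    [Fintype (Epis G X.out)] (f : Quotients G → ℝ) :
    (∑ π : Epis G X.out, f (quotOf π.1 π.2)) / (Nat.card (Aut X.out) : ℝ)
      = ∑ x : Quotients G, if cls (qObj x) = X then f x else 0 := by
  have := hC.autFinite X.out
  have hA : (Nat.card (Aut X.out) : ℝ) ≠ 0 := by
    exact_mod_cast Nat.card_pos.ne'
  rw [div_eq_iff hA, ← Finset.sum_fiberwise Finset.univ (fun π : Epis G X.out => quotOf π.1 π.2),
    Finset.sum_mul]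
  refine Finset.sum_congr rfl fun x _ => ?_
  split_ifs with hx
  · obtain ⟨π, rfl⟩ := (cls_eq_iff x X).1 hx
    rw [Finset.sum_congr rfl (g := fun _ => f (quotOf π.1 π.2))]
    · rw [Finset.sum_const, nsmul_eq_mul, mul_comm, ← card_fibre π, Nat.card_eq_fintype_card,
        Fintype.card_subtype]
    · intro σ hσ
      rw [(Finset.mem_filter.1 hσ).2]
  · rw [zero_mul]
    apply Finset.sum_eq_zero
    intro σ hσ
    exact absurd ((cls_eq_iff x X).2 ⟨σ, (Finset.mem_filter.1 hσ).2⟩) hx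

theorem tsum_epis (hC : IsDiamond C) (G : C) [Fintype (Quotients G)]
    [∀ X : IsoCls C, Fintype (Epis G X.out)] (f : Quotients G → ℝ) :
    ∑' X : IsoCls C, (∑ π : Epis G X.out, f (quotOf π.1 π.2)) / (Nat.card (Aut X.out) : ℝ)
      = ∑ x : Quotients G, f x := by
  simp_rw [sum_epis hC]
  rw [Summable.tsum_finsetSum]
  · refine Finset.sum_congr rfl fun x _ => ?_
    simp_rw [eq_comm (a := cls (qObj x))]
    exact tsum_ite_eq _ _
  · intro x _
    apply summable_of_ne_finset_zero (s := {cls (qObj x)})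
    intro X hX
    rw [if_neg]
    rintro rfl
    simp at hX

/-- Composition with a fixed epi. -/
theorem sum_comp {G F H : C} (π : Epis G F) [Fintype (Epis F H)]
    [Fintype (Epis G H)] (g : Quotients G → ℝ) :
    ∑ ρ : Epis F H, g (quotOf (π.1 ≫ ρ.1) (epiComp π.2 ρ.2)) =
      ∑ φ : Epis G H, if quotOf φ.1 φ.2 ≤ quotOf π.1 π.2 then g (quotOf φ.1 φ.2) else 0 := by
  rw [← Finset.sum_filter]
  refine Finset.sum_bij (fun ρ _ => ⟨π.1 ≫ ρ.1, epiComp π.2 ρ.2⟩) ?_ ?_ ?_ ?_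
  · intro ρ _
    simp only [Finset.mem_filter, Finset.mem_univ, true_and]
    exact (quotOf_le_iff _ _ _ _).2 ⟨ρ.1, rfl⟩
  · intro ρ _ ρ' _ h
    have := π.2
    exact Subtype.ext ((cancel_epi π.1).1 (congrArg Subtype.val h))
  · intro φ hφ
    obtain ⟨ρ, hρ⟩ := (quotOf_le_iff _ _ _ _).1 (Finset.mem_filter.1 hφ).2
    refine ⟨⟨ρ, epi_right (σ := π.1) (by rw [hρ]; exact φ.2)⟩, Finset.mem_univ _, Subtype.ext hρ⟩
  · intro ρ _
    rfl

/-- Pull back quotients of `F` to quotients of `G`. -/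
noncomputable def pull {G F : C} (π : Epis G F) (x : Quotients F) : Quotients G :=
  quotOf (π.1 ≫ qArr x) (epiComp π.2 (exists_quotOf x).1)

theorem pull_quotOf {G F E : C} (π : Epis G F) (ρ : Epis F E) :
    pull π (quotOf ρ.1 ρ.2) = quotOf (π.1 ≫ ρ.1) (epiComp π.2 ρ.2) := by
  obtain ⟨h, hx⟩ := exists_quotOf (quotOf ρ.1 ρ.2)
  obtain ⟨e, he⟩ := (quotOf_eq_iff _ _ _ _).1 hx
  refine (quotOf_eq_iff _ _ _ _).2 ⟨e, ?_⟩
  rw [Category.assoc, he]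

theorem pull_le {G F : C} (π : Epis G F) (x y : Quotients F) :
    pull π x ≤ pull π y ↔ x ≤ y := by
  obtain ⟨hx, ex⟩ := exists_quotOf x
  obtain ⟨hy, ey⟩ := exists_quotOf y
  have := π.2
  have : x ≤ y ↔ quotOf (qArr x) hx ≤ quotOf (qArr y) hy := by
    rw [ex, ey]
  rw [this, quotOf_le_iff]
  unfold pull
  rw [quotOf_le_iff]
  simp only [Category.assoc, cancel_epi]

theorem pull_top {G F : C} (π : Epis G F) : pull π ⊤ = quotOf π.1 π.2 := by
  have h1 : (⊤ : Quotients F) = quotOf (𝟙 F) inferInstance :=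
    ((quotOf_eq_top_iff _ _).2 inferInstance).symm
  rw [h1, pull_quotOf π ⟨𝟙 F, inferInstance⟩]
  simp

theorem pull_surj {G F : C} (π : Epis G F) (z : Quotients G) (hz : z ≤ quotOf π.1 π.2) :
    ∃ y, pull π y = z := by
  obtain ⟨h, ez⟩ := exists_quotOf z
  rw [← ez] at hz
  obtain ⟨ρ, hρ⟩ := (quotOf_le_iff _ _ _ _).1 hz
  have hρe : Epi ρ := epi_right (σ := π.1) (by rw [hρ]; exact h)
  refine ⟨quotOf ρ hρe, ?_⟩
  rw [pull_quotOf π ⟨ρ, hρe⟩]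
  conv_rhs => rw [← ez]
  congr 1

theorem mob_sum {mob : ∀ G : C, Quotients G → Quotients G → ℝ} (hmob : IsMobiusFamily mob)
    (G : C) [Fintype (Quotients G)] (x y : Quotients G) (hxy : x ≤ y) :
    ∑ z : Quotients G, (if x ≤ z ∧ z ≤ y then mob G x z else 0) = if x = y then 1 else 0 := by
  split_ifs with h
  · subst h
    rw [Finset.sum_eq_single x]
    · simp [(hmob G).1]
    · intro z _ hz
      rw [if_neg]
      rintro ⟨h1, h2⟩
      exact hz (le_antisymm h2 h1)
    · simp
  · refine Eq.trans ?_ ((hmob G).2 x y (lt_of_le_of_ne hxy h))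
    rw [finsum_mem_eq_finite_toFinset_sum _ (Set.toFinite _),
      ← Finset.sum_filter]
    refine Finset.sum_congr ?_ fun _ _ => rfl
    ext z
    simp

theorem mob_pull (hC : IsDiamond C) {mob : ∀ G : C, Quotients G → Quotients G → ℝ}
    (hmob : IsMobiusFamily mob) {G F : C} (π : Epis G F) (x : Quotients F) (y : Quotients F)
    (hxy : x ≤ y) : mob F x y = mob G (pull π x) (pull π y) := by
  have := hC.quotFinite F
  have := hC.quotFinite G
  have := Fintype.ofFinite (Quotients F)
  have := Fintype.ofFinite (Quotients G)
  induction y using WellFoundedLT.induction with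
  | ind y ih =>
    have hinj : Function.Injective (pull π) := by
      intro a b hab
      exact le_antisymm ((pull_le π _ _).1 hab.le) ((pull_le π _ _).1 hab.ge)
    have h1 := mob_sum hmob F x y hxy
    have h2 := mob_sum hmob G _ _ ((pull_le π x y).2 hxy)
    have h3 : ∑ z : Quotients G,
        (if pull π x ≤ z ∧ z ≤ pull π y then mob G (pull π x) z else 0) =
        ∑ z : Quotients F, (if x ≤ z ∧ z ≤ y then mob G (pull π x) (pull π z) else 0) := by
      rw [← Finset.sum_filter, ← Finset.sum_filter]
      symm
      refine Finset.sum_bij (fun z _ => pull π z) ?_ ?_ ?_ ?_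
      · intro z hz
        simpa [pull_le] using hz
      · intro a _ b _ h
        exact hinj h
      · intro z hz
        have hz' := (Finset.mem_filter.1 hz).2
        obtain ⟨w, rfl⟩ := pull_surj π z (by
          rw [← pull_top π]
          exact hz'.2.trans ((pull_le π _ _).2 le_top))
        refine ⟨w, ?_, rfl⟩
        simpa [pull_le] using hz'
      · intro _ _
        rfl
    rw [h3] at h2
    simp only [hinj.eq_iff] at h2
    rw [← h1] at h2
    rw [← Finset.add_sum_erase _ _ (Finset.mem_univ y),
      ← Finset.add_sum_erase (Finset.univ) (fun z => if x ≤ z ∧ z ≤ y then mob F x z else 0)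
        (Finset.mem_univ y)] at h2
    have h4 : ∑ z ∈ Finset.univ.erase y,
          (if x ≤ z ∧ z ≤ y then mob G (pull π x) (pull π z) else 0) =
        ∑ z ∈ Finset.univ.erase y, (if x ≤ z ∧ z ≤ y then mob F x z else 0) := by
      refine Finset.sum_congr rfl fun z hz => ?_
      split_ifs with hc
      · exact (ih z (lt_of_le_of_ne hc.2 (Finset.ne_of_mem_erase hz)) hc.1).symm
      · rfl
    rw [h4] at h2
    simp only [hxy, le_refl, and_self, if_true] at h2
    linarith

/-- Other-sided Möbius identity. -/
theorem mob_sum' {mob : ∀ G : C, Quotients G → Quotients G → ℝ} (hmob : IsMobiusFamily mob)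
    (G : C) [Fintype (Quotients G)] (x y : Quotients G) :
    ∑ z : Quotients G, (if x ≤ z ∧ z ≤ y then mob G z y else 0) = if x = y then 1 else 0 := by
  let M : Matrix (Quotients G) (Quotients G) ℝ := fun x y => if x ≤ y then mob G x y else 0
  let Z : Matrix (Quotients G) (Quotients G) ℝ := fun x y => if x ≤ y then 1 else 0
  have h : M * Z = 1 := by
    ext x y
    rw [Matrix.mul_apply, Matrix.one_apply]
    by_cases hxy : x ≤ y
    · rw [← mob_sum hmob G x y hxy]
      refine Finset.sum_congr rfl fun z _ => ?_
      by_cases h1 : x ≤ z <;> by_cases h2 : z ≤ y <;> simp [M, Z, h1, h2]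
    · rw [if_neg (fun h => hxy h.le)]
      refine Finset.sum_eq_zero fun z _ => ?_
      by_cases h1 : x ≤ z
      · have h2 : ¬ z ≤ y := fun h => hxy (h1.trans h)
        simp [Z, h2]
      · simp [M, h1]
  have h' : Z * M = 1 := mul_eq_one_comm.1 h
  have := congrFun (congrFun h' x) y
  rw [Matrix.mul_apply, Matrix.one_apply] at this
  rw [← this]
  refine Finset.sum_congr rfl fun z _ => ?_
  by_cases h1 : x ≤ z <;> by_cases h2 : z ≤ y <;> simp [M, Z, h1, h2]

theorem count_iso (hC : IsDiamond C) (G H : C) [Fintype (Epis G H)] :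
    (∑ φ : Epis G H, if quotOf φ.1 φ.2 = ⊤ then (1 : ℝ) else 0) / (Nat.card (Aut H) : ℝ) =
      if Nonempty (G ≅ H) then (1 : ℝ) else 0 := by
  have := hC.autFinite H
  have hA : (Nat.card (Aut H) : ℝ) ≠ 0 := by
    exact_mod_cast Nat.card_pos.ne'
  split_ifs with h
  · obtain ⟨e⟩ := h
    have he := (quotOf_eq_top_iff e.hom inferInstance).2 inferInstance
    rw [div_eq_iff hA, one_mul, ← card_fibre ⟨e.hom, inferInstance⟩, Nat.card_eq_fintype_card,
        Fintype.card_subtype]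
    simp [he]
  · rw [Finset.sum_eq_zero, zero_div]
    intro φ _
    rw [if_neg]
    intro hφ
    have := (quotOf_eq_top_iff _ _).1 hφ
    exact h ⟨asIso φ.1⟩

/-- The common reorganisation of both sums. -/
theorem reorganise (hC : IsDiamond C) (G H : C) [Fintype (Quotients G)]
    [∀ A B : C, Fintype (Epis A B)] (g : Quotients G → Quotients G → ℝ) :
    ∑' X : IsoCls C, (∑ π : Epis G X.out, ∑ ρ : Epis X.out H,
        g (quotOf (π.1 ≫ ρ.1) (epiComp π.2 ρ.2)) (quotOf π.1 π.2)) / (Nat.card (Aut X.out) : ℝ)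
      = ∑ φ : Epis G H, ∑ x : Quotients G,
        if quotOf φ.1 φ.2 ≤ x then g (quotOf φ.1 φ.2) x else 0 := by
  rw [Finset.sum_comm, ← tsum_epis hC G (fun x => ∑ φ : Epis G H,
    if quotOf φ.1 φ.2 ≤ x then g (quotOf φ.1 φ.2) x else 0)]
  refine tsum_congr fun X => ?_
  congr 1
  refine Finset.sum_congr rfl fun π _ => ?_
  exact sum_comp π (fun a => g a (quotOf π.1 π.2))

theorem main_left (hC : IsDiamond C)
    {mob : ∀ G : C, Quotients G → Quotients G → ℝ} (hmob : IsMobiusFamily mob) (G H : C) :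
    (∑' F : IsoCls C, TQ mob F.out H * SQ G F.out) =
      (if Nonempty (G ≅ H) then (1 : ℝ) else 0) := by
  have := hC.quotFinite G
  have := Fintype.ofFinite (Quotients G)
  have := fun A B : C => finite_epis hC A B
  have := fun A B : C => Fintype.ofFinite (Epis A B)
  have key := reorganise hC G H (mob G)
  have h2 : ∀ φ : Epis G H, (∑ x : Quotients G,
      if quotOf φ.1 φ.2 ≤ x then mob G (quotOf φ.1 φ.2) x else 0) =
      if quotOf φ.1 φ.2 = ⊤ then (1 : ℝ) else 0 := by
    intro φ
    rw [← mob_sum hmob G _ _ le_top]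
    simp
  simp_rw [h2] at key
  rw [← count_iso hC, ← key, ← tsum_div_const]
  refine tsum_congr fun X => ?_
  have h3 : ∀ (π : Epis G X.out) (ρ : Epis X.out H),
      mob G (quotOf (π.1 ≫ ρ.1) (epiComp π.2 ρ.2)) (quotOf π.1 π.2) = muEpi mob ρ.1 ρ.2 := by
    intro π ρ
    unfold muEpi
    rw [mob_pull hC hmob π _ _ le_top, pull_top, pull_quotOf]
  simp_rw [h3]
  unfold TQ muHat SQ
  rw [tsum_fintype, Finset.sum_const, Finset.card_univ, nsmul_eq_mul, Nat.card_eq_fintype_card (α := Epis G X.out)]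
  ring

theorem main_right (hC : IsDiamond C)
    {mob : ∀ G : C, Quotients G → Quotients G → ℝ} (hmob : IsMobiusFamily mob) (G H : C) :
    (∑' F : IsoCls C, TQ mob G F.out * SQ F.out H) =
      (if Nonempty (G ≅ H) then (1 : ℝ) else 0) := by
  have := hC.quotFinite G
  have := Fintype.ofFinite (Quotients G)
  have := fun A B : C => finite_epis hC A B
  have := fun A B : C => Fintype.ofFinite (Epis A B)
  have key := reorganise hC G H (fun _ x => mob G x ⊤)
  have h2 : ∀ φ : Epis G H, (∑ x : Quotients G,
      if quotOf φ.1 φ.2 ≤ x then mob G x ⊤ else 0) =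
      if quotOf φ.1 φ.2 = ⊤ then (1 : ℝ) else 0 := by
    intro φ
    rw [← mob_sum' hmob G]
    simp
  simp_rw [h2] at key
  rw [← count_iso hC, ← key, ← tsum_div_const]
  refine tsum_congr fun X => ?_
  unfold TQ muHat SQ muEpi
  simp_rw [Finset.sum_const, Finset.card_univ, nsmul_eq_mul]
  rw [tsum_fintype, ← Finset.mul_sum, Nat.card_eq_fintype_card (α := Epis X.out H)]
  ring

end Helpers

end MomentCat

open MomentCat in
/-- Lemma 4.1 of the paper:
`∑_{F ∈ I} T_{F,H} S_{G,F} = ∑_{F ∈ I} T_{G,F} S_{F,H}`, and the common value is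
`1` if `G ≅ H` and `0` otherwise. -/
theorem statement0 {C : Type u} [SmallCategory C] (hC : IsDiamond C)
    (mob : ∀ G : C, Quotients G → Quotients G → ℝ) (hmob : IsMobiusFamily mob)
    (G H : C) :
    (∑' F : IsoCls C, TQ mob F.out H * SQ G F.out) =
      (∑' F : IsoCls C, TQ mob G F.out * SQ F.out H) ∧
    (∑' F : IsoCls C, TQ mob F.out H * SQ G F.out) =
      (if Nonempty (G ≅ H) then (1 : ℝ) else 0) := by
  exact ⟨(main_left hC hmob G H).trans (main_right hC hmob G H).symm, main_left hC hmob G H⟩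
end

section
/- Let L be a finite modular lattice with bottom element ⊥ and top element ⊤. If L is not complemented (i.e. some element of L has no complement), then the Möbius function of L satisfies μ(⊥,⊤) = 0. Equivalently: if ⊤ is not the join of the atoms of L, then μ(⊥,⊤) = 0. -/
/-- `μ` is the Möbius function of the lattice `L`: `μ(x,x) = 1` and
`∑_{x ≤ z ≤ y} μ(x,z) = 0` whenever `x < y`. -/
def IsMobiusFn {L : Type*} [PartialOrder L] (μ : L → L → ℝ) : Prop :=
  (∀ x : L, μ x x = 1) ∧ ∀ x y : L, x < y → ∑ᶠ z ∈ Set.Icc x y, μ x z = 0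

theorem mobius_aux {L : Type*} [Lattice L] [BoundedOrder L] [Fintype L]
    (μ : L → L → ℝ) (hμ : IsMobiusFn μ) (s : L) (hs : ∀ a : L, IsAtom a → a ≤ s) (x : L) :
    ¬ x ≤ s → μ ⊥ x = 0 := by
  classical
  induction x using WellFoundedLT.induction with
  | _ x ih =>
  intro hx
  have key : ∀ y : L, y ≠ ⊥ → ∑ z ∈ Finset.univ.filter (· ≤ y), μ ⊥ z = 0 := by
    intro y hy
    rw [← hμ.2 ⊥ y (bot_lt_iff_ne_bot.2 hy), ← finsum_mem_coe_finset]
    have : ((Finset.univ.filter (· ≤ y) : Finset L) : Set L) = Set.Icc ⊥ y := by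
      ext z; simp
    rw [this]
  have hxb : x ≠ ⊥ := by rintro rfl; exact hx bot_le
  have hxs : x ⊓ s ≠ ⊥ := by
    obtain h | ⟨a, ha, hax⟩ := eq_bot_or_exists_atom_le x
    · exact absurd h hxb
    · exact fun h => ha.1 (le_bot_iff.1 (h ▸ le_inf hax (hs a ha)))
  have h1 := key x hxb
  have h2 := key (x ⊓ s) hxs
  rw [← Finset.sum_filter_add_sum_filter_not _ (· ≤ s), Finset.filter_filter,
    Finset.filter_filter] at h1
  simp only [← le_inf_iff] at h1
  rw [h2, zero_add, Finset.sum_eq_single x] at h1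
  · exact h1
  · intro z hz hzx
    simp only [Finset.mem_filter, Finset.mem_univ, true_and] at hz
    exact ih z (lt_of_le_of_ne hz.1 hzx) hz.2
  · intro h
    exact absurd (by simp [hx]) h

theorem compl_aux {L : Type*} [CompleteLattice L] [Finite L] [IsModularLattice L]
    (h : ¬ ComplementedLattice L) : ∃ s : L, (∀ a : L, IsAtom a → a ≤ s) ∧ s ≠ ⊤ :=
  haveI : IsCompactlyGenerated L :=
    CompleteLattice.isCompactlyGenerated_of_wellFoundedGT
  ⟨sSup {a | IsAtom a}, fun _ ha => le_sSup ha,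
    fun e => h (complementedLattice_of_sSup_atoms_eq_top e)⟩

/-- Philip Hall's theorem: in a finite modular lattice that is
not complemented, the Möbius function satisfies `μ(⊥,⊤) = 0`. -/
theorem statement1 {L : Type*} [Lattice L] [BoundedOrder L] [Fintype L]
    [IsModularLattice L] (μ : L → L → ℝ) (hμ : IsMobiusFn μ)
    (h : ¬ ComplementedLattice L) :
    μ ⊥ ⊤ = 0 := by
  classical
  obtain ⟨s, hs, hst⟩ := @compl_aux L (Fintype.toCompleteLattice L) _ ‹_› h
  exact mobius_aux μ hμ s hs ⊤ (fun hle => hst (top_le_iff.1 hle))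
end

section
/- Let C be a diamond category and let W be a formation. Then the set W' of isomorphism classes of objects G of C such that the canonical epimorphism G → G^W is semisimple is itself a formation: it is downward-closed, join-closed, and contains all minimal objects. -/
open CategoryTheory Opposite Filter Topology MeasureTheory
open scoped ENNReal Classical

universe u

namespace MomentCat

variable {C : Type u} [SmallCategory C]

section LatticeFacts

variable {L : Type*} [Lattice L] [IsModularLattice L]

/-- The interval `[u, v]` is complemented, in lattice terms. -/
def IC (u v : L) : Prop := ∀ x, u ≤ x → x ≤ v → ∃ y, u ≤ y ∧ y ≤ v ∧ x ⊔ y = v ∧ x ⊓ y = u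

theorem IC.down {u v v' : L} (h : IC u v) (h1 : u ≤ v') (h2 : v' ≤ v) : IC u v' := by
  intro x hx hxv
  obtain ⟨y, hy, hyv, hs, hi⟩ := h x hx (hxv.trans h2)
  refine ⟨y ⊓ v', le_inf hy h1, inf_le_right, ?_, ?_⟩
  · rw [← sup_inf_assoc_of_le y hxv, hs]
    exact inf_eq_right.2 h2
  · rw [← inf_assoc, hi]
    exact inf_eq_left.2 h1

theorem IC.up {a w : L} (h : IC (a ⊓ w) a) : IC w (a ⊔ w) := by
  intro x hx hxv
  obtain ⟨y, hy, hya, hs, hi⟩ := h (a ⊓ x) (inf_le_inf_left _ hx) inf_le_left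
  have hx' : w ⊔ a ⊓ x = x := by
    rw [← sup_inf_assoc_of_le a hx, sup_comm]; exact inf_eq_right.2 hxv
  refine ⟨y ⊔ w, le_sup_right, sup_le_sup_right hya w, ?_, ?_⟩
  · apply le_antisymm (sup_le hxv (sup_le_sup_right hya w))
    refine sup_le ?_ (hx.trans le_sup_left)
    rw [← hs]
    exact sup_le (inf_le_right.trans le_sup_left) (le_sup_left.trans le_sup_right)
  · have : (w ⊔ y) ⊓ x = w ⊔ y ⊓ x := sup_inf_assoc_of_le y hx
    rw [inf_comm, sup_comm, this]
    refine sup_eq_left.2 ?_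
    have : y ⊓ x ≤ a ⊓ x ⊓ y := le_inf (le_inf (inf_le_left.trans hya) inf_le_right) inf_le_left
    exact (this.trans hi.le).trans inf_le_right

theorem IC.of_up {a w : L} (h : IC w (a ⊔ w)) : IC (a ⊓ w) a := by
  intro x hx hxa
  obtain ⟨y, hy, hyv, hs, hi⟩ := h (x ⊔ w) le_sup_right (sup_le_sup_right hxa w)
  have hxw : (x ⊔ w) ⊓ a = x := by
    rw [sup_inf_assoc_of_le w hxa, inf_comm]; exact sup_eq_left.2 hx
  refine ⟨y ⊓ a, le_inf (inf_le_right.trans hy) inf_le_left, inf_le_right, ?_, ?_⟩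
  · rw [← sup_inf_assoc_of_le y hxa]
    refine inf_eq_right.2 ?_
    have : x ⊔ y = a ⊔ w := by
      rw [← hs, sup_assoc, sup_eq_right.2 hy]
    rw [this]; exact le_sup_left
  · apply le_antisymm
    · refine le_inf (inf_le_left.trans hxa) ?_
      rw [← hi]
      exact le_inf (inf_le_left.trans le_sup_left) (inf_le_right.trans inf_le_left)
    · exact le_inf hx (le_inf (inf_le_right.trans hy) inf_le_left)

theorem IC.sup {w a b₀ : L} (hwa : w ≤ a) (hwb : w ≤ b₀) (ha : IC w a) (hb₀ : IC w b₀) :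
    IC w (a ⊔ b₀) := by
  obtain ⟨b, hwb', hbb, hs, hi⟩ := hb₀ (a ⊓ b₀) (le_inf hwa hwb) inf_le_right
  have hb : IC w b := hb₀.down hwb' hbb
  have hab : a ⊓ b = w := by
    rw [← hi, inf_assoc, inf_eq_right.2 hbb]
  have hsup : a ⊔ b₀ = a ⊔ b := by
    rw [← hs, ← sup_assoc, sup_eq_left.2 (inf_le_left : a ⊓ b₀ ≤ a)]
  rw [hsup]
  intro x hx hxv
  obtain ⟨q, hwq, hqa, hqs, hqi⟩ := ha (x ⊓ a) (le_inf hx hwa) inf_le_right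
  obtain ⟨p, hwp, hpb, hps, hpi⟩ := hb ((x ⊔ a) ⊓ b) (le_inf (hx.trans le_sup_left) hwb')
    inf_le_right
  refine ⟨q ⊔ p, hwq.trans le_sup_left, sup_le_sup hqa hpb, ?_, ?_⟩
  · apply le_antisymm (sup_le hxv (sup_le_sup hqa hpb))
    have h1 : a ≤ x ⊔ (q ⊔ p) := by
      conv_lhs => rw [← hqs]
      exact sup_le (inf_le_left.trans le_sup_left) (le_sup_left.trans le_sup_right)
    refine sup_le h1 ?_
    conv_lhs => rw [← hps]
    exact sup_le (inf_le_left.trans (sup_le le_sup_left h1)) (le_sup_right.trans le_sup_right)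
  · apply le_antisymm _ (le_inf hx (hwq.trans le_sup_left))
    have e1 : (a ⊔ p) ⊓ (x ⊔ a) ≤ a := by
      rw [sup_inf_assoc_of_le p (le_sup_right : a ≤ x ⊔ a)]
      refine sup_le le_rfl ?_
      refine le_trans ?_ (hpi.le.trans hwa)
      exact le_inf (le_inf inf_le_right (inf_le_left.trans hpb)) inf_le_left
    have z1 : x ⊓ (q ⊔ p) ≤ a := le_trans
      (le_inf (inf_le_right.trans (sup_le_sup_right hqa p)) (inf_le_left.trans le_sup_left)) e1
    have e2 : (q ⊔ p) ⊓ a ≤ q := by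
      rw [sup_inf_assoc_of_le p hqa]
      refine sup_le le_rfl ?_
      refine le_trans ?_ (hab.le.trans hwq)
      exact le_inf inf_le_right (inf_le_left.trans hpb)
    rw [← hqi]
    exact le_inf (le_inf inf_le_left z1) ((le_inf inf_le_right z1).trans e2)

end LatticeFacts

section Push

variable {D : Type*} [Category D]

/-- Push forward subobjects along a monomorphism. -/
noncomputable def push {X Y : D} (f : X ⟶ Y) [Mono f] (x : Subobject X) : Subobject Y :=
  Subobject.mk (x.arrow ≫ f)

theorem push_le {X Y : D} (f : X ⟶ Y) [Mono f] (x : Subobject X) : push f x ≤ Subobject.mk f :=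
  Subobject.mk_le_mk_of_comm x.arrow rfl

theorem push_le_iff {X Y : D} (f : X ⟶ Y) [Mono f] (x y : Subobject X) :
    push f x ≤ push f y ↔ x ≤ y := by
  constructor
  · intro h
    refine Subobject.le_of_comm (Subobject.ofMkLEMk _ _ h) ?_
    rw [← cancel_mono f, Category.assoc]
    exact Subobject.ofMkLEMk_comp h
  · intro h
    refine Subobject.mk_le_mk_of_comm (Subobject.ofLE x y h) ?_
    rw [← Category.assoc, Subobject.ofLE_arrow]

theorem push_surj {X Y : D} (f : X ⟶ Y) [Mono f] (y : Subobject Y) (h : y ≤ Subobject.mk f) :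
    ∃ x, push f x = y := by
  have hc : Subobject.ofLEMk y f h ≫ f = y.arrow := Subobject.ofLEMk_comp h
  refine ⟨Subobject.mk (Subobject.ofLEMk y f h), ?_⟩
  refine Subobject.mk_eq_of_comm _ (Subobject.underlyingIso _) ?_
  rw [← hc, ← Category.assoc, Subobject.underlyingIso_hom_comp_eq_mk]

theorem push_top {X Y : D} (f : X ⟶ Y) [Mono f] : push f ⊤ = Subobject.mk f := by
  obtain ⟨x, hx⟩ := push_surj f _ le_rfl
  refine le_antisymm (push_le f _) ?_
  rw [← hx, push_le_iff]; exact le_top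

end Push

section Main

variable {C : Type u} [SmallCategory C]

theorem qSup_lub (hC : IsDiamond C) {G : C} (a b : Quotients G) : IsLUB {a, b} (qSup a b) := by
  have h := hC.lub G a b
  unfold qSup; rw [dif_pos h]; exact h.choose_spec

theorem qInf_glb (hC : IsDiamond C) {G : C} (a b : Quotients G) : IsGLB {a, b} (qInf a b) := by
  have h := hC.glb G a b
  unfold qInf; rw [dif_pos h]; exact h.choose_spec

/-- The lattice of quotients. -/
noncomputable abbrev qLattice (hC : IsDiamond C) (G : C) : Lattice (Quotients G) :=
  { (inferInstance : PartialOrder (Quotients G)) with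
    sup := qSup
    inf := qInf
    le_sup_left := fun a b => (qSup_lub hC a b).1 (by simp)
    le_sup_right := fun a b => (qSup_lub hC a b).1 (by simp)
    sup_le := fun a b c h1 h2 => (qSup_lub hC a b).2 (by
      rintro x (rfl | rfl) <;> assumption)
    inf_le_left := fun a b => (qInf_glb hC a b).1 (by simp)
    inf_le_right := fun a b => (qInf_glb hC a b).1 (by simp)
    le_inf := fun a b c h1 h2 => (qInf_glb hC b c).2 (by
      rintro x (rfl | rfl) <;> assumption) }

theorem qModular (hC : IsDiamond C) (G : C) : 
    letI := qLattice hC G; IsModularLattice (Quotients G) := by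
  letI := qLattice hC G
  exact ⟨fun {x} y {z} h => (hC.modular G x z y h).ge⟩

theorem epi_unop_of {X Y : Cᵒᵖ} (f : X ⟶ Y) (h : Mono f) : Epi f.unop := inferInstance

theorem mem_of_le {W : Set C} (hW : DownwardClosed W) {G : C} {y w : Quotients G} (h : y ≤ w)
    (hw : qObj w ∈ W) : qObj y ∈ W :=
  hW _ hw _ (Subobject.ofLE y w h).unop
    (epi_unop_of (Subobject.ofLE y w h) inferInstance)

theorem wQuot_char (hC : IsDiamond C) {W : Set C} (hW : IsFormation W) (G : C)
    (y : Quotients G) : y ≤ wQuot W G ↔ qObj y ∈ W := by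
  haveI := hC.quotFinite G
  set S : Set (Quotients G) := {a | qObj a ∈ W} with hS
  have hne : S.Nonempty := by
    obtain ⟨m, hm⟩ := (Set.toFinite (Set.univ : Set (Quotients G))).exists_minimal ⟨⊤, trivial⟩
    refine ⟨m, hW.2.2 _ ⟨fun x y => ?_⟩⟩
    have key : ∀ z : Subobject (Subobject.underlying.obj m), push m.arrow z = m := fun z => by
      have h1 : push m.arrow z ≤ m := by
        have := push_le m.arrow z
        rwa [Subobject.mk_arrow] at this
      exact le_antisymm h1 (hm.2 trivial h1)
    apply le_antisymm
    · exact (push_le_iff m.arrow x y).1 ((key x).trans (key y).symm).le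
    · exact (push_le_iff m.arrow y x).1 ((key y).trans (key x).symm).le
  obtain ⟨m, hm⟩ := (Set.toFinite S).exists_maximal hne
  have hmS : qObj m ∈ W := hm.1
  have hub : IsLUB S m := by
    refine ⟨fun a ha => ?_, fun b hb => hb hm.1⟩
    have h1 : qObj (qSup m a) ∈ W := hW.2.1 G m a hmS ha (hC.lub G m a)
    have h2 := qSup_lub hC m a
    exact (h2.1 (by simp : a ∈ ({m, a} : Set _))).trans
      (hm.2 h1 (h2.1 (by simp : m ∈ ({m, a} : Set _))))
  have hw : wQuot W G = m := by
    have hex : ∃ c, IsLUB S c := ⟨m, hub⟩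
    unfold wQuot qsSup
    rw [dif_pos hex]
    exact hex.choose_spec.unique hub
  rw [hw]
  exact ⟨fun h => mem_of_le hW.1 h hmS, fun h => hub.1 h⟩

theorem qObj_push {W : Set C} (hW : DownwardClosed W) {G F : C} (f : op F ⟶ op G) [Mono f]
    (x : Quotients F) : qObj (push f x : Quotients G) ∈ W ↔ qObj x ∈ W := by
  let i := Subobject.underlyingIso (x.arrow ≫ f)
  exact ⟨fun h => hW _ h _ i.inv.unop (epi_unop_of i.inv inferInstance), 
    fun h => hW _ h _ i.hom.unop (epi_unop_of i.hom inferInstance)⟩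

theorem mem_iff (hC : IsDiamond C) {W : Set C} (hW : IsFormation W) {G F : C}
    (f : op F ⟶ op G) [Mono f] :
    letI := qLattice hC G
    IntervalComplTop (wQuot W F) ↔
      IC ((Subobject.mk f : Quotients G) ⊓ wQuot W G) (Subobject.mk f) := by
  letI := qLattice hC G
  letI := qLattice hC F
  have hle := push_le_iff f
  have hinj : ∀ x y, push f x = push f y → x = y := fun x y h =>
    le_antisymm ((hle x y).1 h.le) ((hle y x).1 h.ge)
  have hw : push f (wQuot W F) = (Subobject.mk f : Quotients G) ⊓ wQuot W G := by
    apply le_antisymm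
    · refine le_inf (push_le f _) ?_
      rw [wQuot_char hC hW, qObj_push hW.1, ← wQuot_char hC hW]
    · obtain ⟨z, hz⟩ := push_surj f ((Subobject.mk f : Quotients G) ⊓ wQuot W G) inf_le_left
      rw [← hz, hle, wQuot_char hC hW, ← qObj_push hW.1 f, hz, ← wQuot_char hC hW]
      exact inf_le_right
  have hsup : ∀ x y : Quotients F, push f (x ⊔ y) = (push f x ⊔ push f y : Quotients G) := by
    intro x y
    apply le_antisymm
    · obtain ⟨z, hz⟩ := push_surj f (push f x ⊔ push f y : Quotients G)
        (sup_le (push_le f x) (push_le f y))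
      rw [← hz, hle]
      refine sup_le ((hle _ _).1 ?_) ((hle _ _).1 ?_) <;> rw [hz]
      exacts [le_sup_left, le_sup_right]
    · exact sup_le ((hle _ _).2 le_sup_left) ((hle _ _).2 le_sup_right)
  have hinf : ∀ x y : Quotients F, push f (x ⊓ y) = (push f x ⊓ push f y : Quotients G) := by
    intro x y
    apply le_antisymm
    · exact le_inf ((hle _ _).2 inf_le_left) ((hle _ _).2 inf_le_right)
    · obtain ⟨z, hz⟩ := push_surj f (push f x ⊓ push f y : Quotients G)
        (inf_le_left.trans (push_le f x))
      rw [← hz, hle]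
      refine le_inf ((hle _ _).1 ?_) ((hle _ _).1 ?_) <;> rw [hz]
      exacts [inf_le_left, inf_le_right]
  rw [← hw]
  constructor
  · intro h X hX hXf
    obtain ⟨x, rfl⟩ := push_surj f X hXf
    obtain ⟨y, h1, h2, h3⟩ := h x ((hle _ _).1 hX)
    refine ⟨push f y, (hle _ _).2 h1, push_le f y, ?_, ?_⟩
    · rw [← hsup, ← push_top f]; exact congrArg _ h2
    · rw [← hinf]; exact congrArg _ h3
  · intro h x hx
    obtain ⟨Y, h1, h2, h3, h4⟩ := h (push f x) ((hle _ _).2 hx) (push_le f x)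
    obtain ⟨y, rfl⟩ := push_surj f Y h2
    refine ⟨y, (hle _ _).1 h1, hinj _ _ ?_, hinj _ _ ?_⟩
    · rw [push_top]; exact (hsup x y).trans h3
    · exact (hinf x y).trans h4

theorem mem_iff_of_eq (hC : IsDiamond C) {W : Set C} (hW : IsFormation W) {G F : C}
    (f : op F ⟶ op G) (hf : Mono f) (a : Quotients G) (ha : Subobject.mk f = a) :
    letI := qLattice hC G
    IntervalComplTop (wQuot W F) ↔ IC (a ⊓ wQuot W G) a := by
  subst ha
  exact mem_iff hC hW f

theorem mem_iff' (hC : IsDiamond C) {W : Set C} (hW : IsFormation W) {G : C}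
    (a : Quotients G) :
    letI := qLattice hC G
    IntervalComplTop (wQuot W (qObj a)) ↔ IC (a ⊓ wQuot W G) a :=
  mem_iff_of_eq hC hW (F := qObj a) (Subobject.arrow a) (Subobject.arrow_mono a) a
    (Subobject.mk_arrow a)

end Main

end MomentCat

open MomentCat in
/-- for a formation `W` in a diamond category, the set of objects
`G` such that `G → G^W` is semisimple is itself a formation. -/
theorem statement2 {C : Type u} [SmallCategory C] (hC : IsDiamond C)
    (W : Set C) (hW : IsFormation W) :
    IsFormation {G : C | IntervalComplTop (wQuot W G)} := by
  refine ⟨?_, ?_, ?_⟩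
  · intro G hG F π hπ
    letI := qLattice hC G
    haveI := qModular hC G
    refine (mem_iff hC hW π.op).2 (IC.of_up (IC.down (v := ⊤) ?_ le_sup_right le_top))
    intro X hX _
    obtain ⟨Y, h1, h2, h3⟩ := hG X hX
    exact ⟨Y, h1, le_top, h2, h3⟩
  · intro G a b ha hb _
    letI := qLattice hC G
    haveI := qModular hC G
    have ha' := ((mem_iff' hC hW a).1 ha).up
    have hb' := ((mem_iff' hC hW b).1 hb).up
    refine (mem_iff' hC hW (qSup a b)).2 (IC.of_up ?_)
    have h := IC.sup le_sup_right le_sup_right ha' hb'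
    have e : a ⊔ wQuot W G ⊔ (b ⊔ wQuot W G) = a ⊔ b ⊔ wQuot W G := by
      rw [sup_sup_sup_comm, sup_idem]
    rw [e] at h
    exact h
  · intro G hG X _
    haveI : Subsingleton (Quotients G) := hG
    exact ⟨X, (Subsingleton.elim _ _).le, Subsingleton.elim _ _, Subsingleton.elim _ _⟩
end

section
/- In a diamond category, every level has finite complexity; more precisely, if a level 𝒞 is generated by objects G₁,…,Gₙ and k is the maximal complexity among the G_i, then every object of 𝒞 has complexity at most k. -/
open CategoryTheory Opposite Filter Topology MeasureTheory
open scoped ENNReal Classical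

universe u

namespace S3

/-- order-theoretic complementedness of an interval -/
def CompP {α : Type*} [PartialOrder α] (a b : α) : Prop :=
  ∀ x, a ≤ x → x ≤ b → ∃ y, a ≤ y ∧ y ≤ b ∧ (∀ z, x ≤ z → y ≤ z → z ≤ b → z = b) ∧
    (∀ z, z ≤ x → z ≤ y → a ≤ z → z = a)

/-- order-theoretic complexity bound -/
def CxTo {α : Type*} [PartialOrder α] (t : α) (k : ℕ) : Prop :=
  ∃ c : Fin (k + 1) → α, (∀ x, x ≤ t → c 0 ≤ x) ∧ c (Fin.last k) = t ∧
    ∀ i : Fin k, c i.castSucc ≤ c i.succ ∧ CompP (c i.castSucc) (c i.succ)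

section lattice
variable {α : Type*} [Lattice α]

theorem compP_iff (a b : α) : CompP a b ↔
    ∀ x, a ≤ x → x ≤ b → ∃ y, a ≤ y ∧ y ≤ b ∧ x ⊔ y = b ∧ x ⊓ y = a := by
  refine forall_congr' fun x => forall_congr' fun h1 => forall_congr' fun h2 =>
    exists_congr fun y => and_congr_right fun h3 => and_congr_right fun h4 => and_congr ?_ ?_
  · constructor
    · intro h
      exact h _ le_sup_left le_sup_right (sup_le h2 h4)
    · rintro rfl z hx hy hz
      exact le_antisymm hz (sup_le hx hy)
  · constructor
    · intro h
      exact h _ inf_le_left inf_le_right (le_inf h1 h3)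
    · rintro rfl z hx hy hz
      exact le_antisymm (le_inf hx hy) hz

variable [IsModularLattice α]

theorem compP_inf {a b : α} (hab : a ≤ b) (h : CompP a b) (s : α) :
    CompP (a ⊓ s) (b ⊓ s) := by
  rw [compP_iff] at *
  intro x h1 h2
  have hxb : x ≤ b := h2.trans inf_le_left
  have hxs : x ≤ s := h2.trans inf_le_right
  obtain ⟨y, y1, y2, y3, y4⟩ := h (a ⊔ x) le_sup_left (sup_le hab hxb)
  refine ⟨y ⊓ s, inf_le_inf_right _ y1, inf_le_inf_right _ y2, ?_, ?_⟩
  · rw [sup_inf_assoc_of_le y hxs |>.symm]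
    congr 1
    rw [← y3, sup_comm a x, sup_assoc, sup_eq_right.2 y1]
  · apply le_antisymm
    · rw [← inf_assoc]
      refine inf_le_inf_right _ ?_
      rw [← y4]
      exact inf_le_inf_right _ le_sup_right
    · exact le_inf h1 (inf_le_inf_right _ y1)

theorem compP_sup {a b : α} (hab : a ≤ b) (h : CompP a b) (s : α) :
    CompP (a ⊔ s) (b ⊔ s) := by
  rw [compP_iff] at *
  intro x h1 h2
  have hxa : a ≤ x := le_sup_left.trans h1
  have hxs : s ≤ x := le_sup_right.trans h1
  obtain ⟨y, y1, y2, y3, y4⟩ := h (b ⊓ x) (le_inf hab hxa) inf_le_left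
  refine ⟨y ⊔ s, sup_le_sup_right y1 _, sup_le_sup_right y2 _, ?_, ?_⟩
  · apply le_antisymm
    · exact sup_le h2 (sup_le_sup_right y2 _)
    · rw [← sup_assoc]
      refine sup_le_sup_right ?_ _
      rw [← y3]
      exact sup_le_sup_right inf_le_right _
  · rw [← inf_sup_assoc_of_le y hxs]
    congr 1
    rw [← y4, inf_comm b x, inf_assoc, inf_eq_right.2 y2]

theorem compP_join {e p q : α} (hp : e ≤ p) (hq : e ≤ q) (h : CompP e p) (h' : CompP e q) :
    CompP e (p ⊔ q) := by
  obtain ⟨r, r1, r2, r3, r4⟩ := (compP_iff _ _).1 h' (p ⊓ q) (le_inf hp hq) inf_le_right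
  have hr : CompP e r := by
    have := compP_inf hq h' r
    rwa [inf_eq_left.2 r1, inf_eq_right.2 r2] at this
  have hpr : p ⊔ r = p ⊔ q := by
    rw [← r3, ← sup_assoc, sup_inf_self]
  have hpr' : p ⊓ r = e := by
    rw [← r4, inf_assoc, inf_eq_right.2 r2]
  rw [← hpr]
  rw [compP_iff] at *
  intro x h1 h2
  obtain ⟨y, y1, y2, y3, y4⟩ := h (x ⊓ p) (le_inf h1 hp) inf_le_right
  obtain ⟨w, w1, w2, w3, w4⟩ := hr ((x ⊔ p) ⊓ r) (le_inf (h1.trans le_sup_left) r1) inf_le_right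
  refine ⟨y ⊔ w, y1.trans le_sup_left, sup_le_sup y2 w2, ?_, ?_⟩
  · apply le_antisymm (sup_le h2 (sup_le_sup y2 w2))
    have hpx : p ≤ x ⊔ (y ⊔ w) := by
      rw [← y3]
      exact sup_le (inf_le_left.trans le_sup_left) (le_sup_left.trans le_sup_right)
    refine sup_le hpx ?_
    rw [← w3]
    exact sup_le (inf_le_left.trans (sup_le le_sup_left hpx)) (le_sup_right.trans le_sup_right)
  · apply le_antisymm _ (le_inf h1 (y1.trans le_sup_left))
    have e1 : (x ⊔ p) ⊓ w = e := by
      rw [← w4, inf_assoc, inf_eq_right.2 w2]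
    have e2 : x ⊓ (y ⊔ w) ≤ p := by
      calc x ⊓ (y ⊔ w) ≤ (p ⊔ w) ⊓ (x ⊔ p) :=
            le_inf (inf_le_right.trans (sup_le_sup_right y2 _)) (inf_le_left.trans le_sup_left)
        _ = p ⊔ w ⊓ (x ⊔ p) := sup_inf_assoc_of_le _ le_sup_right
        _ ≤ p := sup_le le_rfl (by rw [inf_comm, e1]; exact hp)
    have e3 : x ⊓ (y ⊔ w) ≤ y := by
      calc x ⊓ (y ⊔ w) ≤ (y ⊔ w) ⊓ p := le_inf inf_le_right e2
        _ = y ⊔ w ⊓ p := sup_inf_assoc_of_le _ y2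
        _ ≤ y := sup_le le_rfl (by
          refine le_trans ?_ y1
          rw [← hpr', inf_comm]; exact inf_le_inf_left _ w2)
    rw [← y4]
    exact le_inf (le_inf inf_le_left e2) e3

theorem cxTo_le {s t : α} {k : ℕ} (hst : s ≤ t) (h : CxTo t k) : CxTo s k := by
  obtain ⟨c, c0, c1, c2⟩ := h
  refine ⟨fun i => c i ⊓ s, fun x hx => inf_le_left.trans (c0 x (hx.trans hst)), ?_, fun i =>
    ⟨inf_le_inf_right _ (c2 i).1, compP_inf (c2 i).1 (c2 i).2 s⟩⟩
  simp only [c1]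
  exact inf_eq_right.2 hst

theorem cxTo_sup {s t : α} {k : ℕ} (h : CxTo s k) (h' : CxTo t k) : CxTo (s ⊔ t) k := by
  obtain ⟨c, c0, c1, c2⟩ := h
  obtain ⟨d, d0, d1, d2⟩ := h'
  refine ⟨fun i => c i ⊔ d i, fun x hx => sup_le ?_ ?_, ?_, fun i =>
    ⟨sup_le_sup (c2 i).1 (d2 i).1, ?_⟩⟩
  · exact (c0 (x ⊓ s) inf_le_right).trans inf_le_left
  · exact (d0 (x ⊓ t) inf_le_right).trans inf_le_left
  · simp only [c1, d1]
  · have h1 := compP_sup (c2 i).1 (c2 i).2 (d i.castSucc)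
    have h2 := compP_sup (d2 i).1 (d2 i).2 (c i.castSucc)
    rw [sup_comm] at h2
    have h3 := compP_join (sup_le_sup_right (c2 i).1 _)
      (by rw [sup_comm]; exact sup_le_sup_right (d2 i).1 _) h1 h2
    convert h3 using 1
    apply le_antisymm
    · exact sup_le (le_sup_left.trans le_sup_left) (le_sup_left.trans le_sup_right)
    · exact sup_le (sup_le_sup_left (d2 i).1 _)
        (sup_le le_sup_right ((c2 i).1.trans le_sup_left))

end lattice

section transfer
variable {α β : Type*} [PartialOrder α] [PartialOrder β]

theorem compP_map (f : α ↪o β) (hf : ∀ x y, y ≤ f x → ∃ z, f z = y) (a b : α) :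
    CompP a b ↔ CompP (f a) (f b) := by
  constructor
  · intro h x h1 h2
    obtain ⟨x, rfl⟩ := hf _ _ h2
    obtain ⟨y, y1, y2, y3, y4⟩ := h x (by simpa using h1) (by simpa using h2)
    refine ⟨f y, by simpa using y1, by simpa using y2, ?_, ?_⟩
    · intro z z1 z2 z3
      obtain ⟨z, rfl⟩ := hf _ _ z3
      rw [y3 z (by simpa using z1) (by simpa using z2) (by simpa using z3)]
    · intro z z1 z2 z3
      obtain ⟨z, rfl⟩ := hf _ _ z1
      rw [y4 z (by simpa using z1) (by simpa using z2) (by simpa using z3)]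
  · intro h x h1 h2
    obtain ⟨y, y1, y2, y3, y4⟩ := h (f x) (by simpa using h1) (by simpa using h2)
    obtain ⟨y, rfl⟩ := hf _ _ y2
    refine ⟨y, by simpa using y1, by simpa using y2, ?_, ?_⟩
    · intro z z1 z2 z3
      exact f.injective (y3 (f z) (by simpa using z1) (by simpa using z2) (by simpa using z3))
    · intro z z1 z2 z3
      exact f.injective (y4 (f z) (by simpa using z1) (by simpa using z2) (by simpa using z3))

theorem cxTo_map (f : α ↪o β) (hf : ∀ x y, y ≤ f x → ∃ z, f z = y) (t : α) (k : ℕ) :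
    CxTo t k ↔ CxTo (f t) k := by
  constructor
  · rintro ⟨c, c0, c1, c2⟩
    refine ⟨fun i => f (c i), ?_, by simp only [c1], fun i =>
      ⟨by simpa using (c2 i).1, (compP_map f hf _ _).1 (c2 i).2⟩⟩
    intro x hx
    obtain ⟨x, rfl⟩ := hf _ _ hx
    simpa using c0 x (by simpa using hx)
  · rintro ⟨c, c0, c1, c2⟩
    have hm : Monotone c := Fin.monotone_iff_le_succ.2 fun i => (c2 i).1
    have : ∀ i, ∃ z, f z = c i := fun i => hf t _ (by rw [← c1]; exact hm (Fin.le_last i))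
    choose d hd using this
    refine ⟨d, ?_, f.injective (by rw [hd, c1]), fun i => ⟨?_, ?_⟩⟩
    · intro x hx
      rw [← f.le_iff_le, hd]
      exact c0 _ (by simpa using hx)
    · rw [← f.le_iff_le, hd, hd]
      exact (c2 i).1
    · rw [compP_map f hf, hd, hd]
      exact (c2 i).2

end transfer

section cat
open MomentCat
variable {C : Type u} [SmallCategory C]

theorem isLUB_qSup (hC : IsDiamond C) {G : C} (a b : Quotients G) : IsLUB {a, b} (qSup a b) := by
  unfold qSup
  rw [dif_pos (hC.lub G a b)]
  exact (hC.lub G a b).choose_spec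

theorem isGLB_qInf (hC : IsDiamond C) {G : C} (a b : Quotients G) : IsGLB {a, b} (qInf a b) := by
  unfold qInf
  rw [dif_pos (hC.glb G a b)]
  exact (hC.glb G a b).choose_spec

/-- the lattice of quotients -/
@[reducible] noncomputable def qLat (hC : IsDiamond C) (G : C) : Lattice (Quotients G) :=
  { (inferInstance : PartialOrder (Quotients G)) with
    sup := qSup
    inf := qInf
    le_sup_left := fun a b => (isLUB_qSup hC a b).1 (by simp)
    le_sup_right := fun a b => (isLUB_qSup hC a b).1 (by simp)
    sup_le := fun a b c h1 h2 => (isLUB_qSup hC a b).2 (by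
      rintro x (rfl | rfl) <;> assumption)
    inf_le_left := fun a b => (isGLB_qInf hC a b).1 (by simp)
    inf_le_right := fun a b => (isGLB_qInf hC a b).1 (by simp)
    le_inf := fun a b c h1 h2 => (isGLB_qInf hC b c).2 (by
      rintro x (rfl | rfl) <;> assumption) }

theorem qMod (hC : IsDiamond C) (G : C) :
    @IsModularLattice (Quotients G) (qLat hC G) := by
  letI := qLat hC G
  refine ⟨fun {a} x b hab => ?_⟩
  exact (hC.modular G a b x hab).ge

theorem intervalCompl_iff (hC : IsDiamond C) {G : C} (a b : Quotients G) :
    IntervalCompl a b ↔ CompP a b :=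
  letI := qLat hC G
  (compP_iff a b).symm

theorem qBot_le (hC : IsDiamond C) {G : C} (x : Quotients G) : qBot G ≤ x := by
  have h : ∃ b : Quotients G, ∀ x, b ≤ x := by
    letI := qLat hC G
    haveI := hC.quotFinite G
    obtain ⟨b, hb⟩ := (Set.finite_univ (α := Quotients G)).exists_minimal ⟨⊤, trivial⟩
    refine ⟨b, fun x => ?_⟩
    exact (hb.2 (y := b ⊓ x) trivial inf_le_left).trans inf_le_right
  unfold qBot
  rw [dif_pos h]
  exact h.choose_spec x

theorem complexity_iff (hC : IsDiamond C) (G : C) (k : ℕ) :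
    complexityLE G k ↔ CxTo (⊤ : Quotients G) k := by
  refine exists_congr fun c => and_congr ?_ (and_congr_right fun _ => forall_congr' fun i =>
    and_congr_right fun _ => intervalCompl_iff hC _ _)
  constructor
  · intro h x _
    rw [h]; exact qBot_le hC x
  · intro h
    exact le_antisymm (h _ le_top) (qBot_le hC _)

/-- quotients of a quotient, as quotients -/
noncomputable def mapEmb {D : Type*} [Category D] {X Y : D} (f : X ⟶ Y) [Mono f] :
    Subobject X ↪o Subobject Y :=
  OrderEmbedding.ofMapLEIff (Subobject.map f).obj (by
    intro a b
    constructor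
    · intro h
      induction a using Subobject.ind
      induction b using Subobject.ind
      simp only [Subobject.map_mk] at h
      exact Subobject.mk_le_mk_of_comm (Subobject.ofMkLEMk _ _ h) (by simp [← cancel_mono f])
    · intro h
      exact (Subobject.map f).monotone h)

theorem mapEmb_top {D : Type*} [Category D] {X Y : D} (f : X ⟶ Y) [Mono f] :
    mapEmb f ⊤ = Subobject.mk f := by
  exact Subobject.map_top f

theorem mapEmb_lower {D : Type*} [Category D] {X Y : D} (f : X ⟶ Y) [Mono f] :
    ∀ x y, y ≤ mapEmb f x → ∃ z, mapEmb f z = y := by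
  intro x y h
  have h' : y ≤ Subobject.mk f := by
    rw [← mapEmb_top f]
    exact h.trans ((mapEmb f).monotone le_top)
  refine ⟨Subobject.mk (Subobject.ofLEMk y f h'), ?_⟩
  have e : (Subobject.map f).obj (Subobject.mk (Subobject.ofLEMk y f h')) = y := by
    rw [Subobject.map_mk]
    simp
  exact e

theorem complexity_mono {G : C} {X : Cᵒᵖ} (hC : IsDiamond C) (f : X ⟶ op G) [Mono f] (k : ℕ) :
    complexityLE (unop X) k ↔ CxTo (Subobject.mk f : Quotients G) k := by
  rw [← mapEmb_top f, ← cxTo_map (mapEmb f) (mapEmb_lower f)]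
  exact complexity_iff hC (unop X) k

theorem complexity_qObj {G : C} (hC : IsDiamond C) (a : Quotients G) (k : ℕ) :
    complexityLE (qObj a) k ↔ CxTo a k := by
  have := complexity_mono hC a.arrow k
  rw [Subobject.mk_arrow] at this
  exact this

theorem isFormation_cx (hC : IsDiamond C) (k : ℕ) :
    IsFormation {G : C | complexityLE G k} := by
  refine ⟨?_, ?_, ?_⟩
  · intro G hG F π hπ
    letI := qLat hC G
    haveI := qMod hC G
    exact (complexity_mono hC π.op k).2 (cxTo_le le_top ((complexity_iff hC G k).1 hG))
  · intro G a b ha hb _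
    letI := qLat hC G
    haveI := qMod hC G
    exact (complexity_qObj hC _ k).2 (cxTo_sup ((complexity_qObj hC a k).1 ha)
      ((complexity_qObj hC b k).1 hb))
  · intro G hG
    haveI : Subsingleton (Quotients G) := hG
    refine (complexity_iff hC G k).2 ⟨fun _ => ⊤, fun x _ => (Subsingleton.elim _ _).le, rfl,
      fun i => ⟨le_rfl, fun x _ _ => ⟨x, (Subsingleton.elim _ _).le, le_top,
        fun z _ _ _ => Subsingleton.elim _ _, fun z _ _ _ => Subsingleton.elim _ _⟩⟩⟩

end cat
end S3

open MomentCat in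
/-- every level of a diamond category has finite complexity;
precisely, if a level is generated by `G₁, …, Gₙ`, of complexity at most `k`,
then every object of the level has complexity at most `k`. -/
theorem statement3 {C : Type u} [SmallCategory C] (hC : IsDiamond C)
    (n : ℕ) (Gs : Fin n → C) (k : ℕ) (hk : ∀ i : Fin n, complexityLE (Gs i) k) :
    ∀ H ∈ levelGen (Set.range Gs), complexityLE H k := by
  intro H hH
  exact hH _ ⟨S3.isFormation_cx hC k, by rintro _ ⟨i, rfl⟩; exact hk i⟩
end

section
/- Let C be a diamond category, W a narrow formation, F ∈ W, and d a natural number. Then there are only finitely many isomorphism classes of objects G ∈ W admitting an epimorphism G → F of dimension d. -/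
open CategoryTheory Opposite Filter Topology MeasureTheory
open scoped ENNReal Classical

universe u

namespace MomentCat

variable {C : Type u} [SmallCategory C]

theorem exists_rep {G : C} (a : Quotients G) :
    ∃ (Y : IsoCls C) (ρ : G ⟶ Y.out) (h : Epi ρ), quotOf ρ h = a := by
  obtain ⟨e⟩ : Nonempty ((cls (qObj a)).out ≅ qObj a) :=
    Quotient.exact (Quotient.out_eq (cls (qObj a)))
  obtain ⟨r, hr⟩ : ∃ r : G ⟶ qObj a, r = a.arrow.unop := ⟨_, rfl⟩
  have h0 : Epi r := hr ▸ inferInstanceAs (Epi a.arrow.unop)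
  have h : Epi (r ≫ e.inv) := epiComp h0 inferInstance
  refine ⟨cls (qObj a), r ≫ e.inv, h, ?_⟩
  unfold quotOf
  symm
  refine Subobject.eq_mk_of_comm _ e.op ?_
  apply Quiver.Hom.unop_inj
  have key : (r ≫ e.inv) ≫ e.hom = r := by simp
  exact key.trans hr

theorem exists_factor {G F H : C} (π : G ⟶ F) (hπ : Epi π) (ρ : G ⟶ H) (hρ : Epi ρ)
    (hle : quotOf π hπ ≤ quotOf ρ hρ) : ∃ σ : H ⟶ F, ρ ≫ σ = π := by
  unfold quotOf at hle
  refine ⟨(Subobject.ofMkLEMk _ _ hle).unop, ?_⟩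
  apply Quiver.Hom.op_inj
  exact Subobject.ofMkLEMk_comp hle

theorem simple_of_covBy {G F H : C} (π : G ⟶ F) (hπ : Epi π) (ρ : G ⟶ H) (hρ : Epi ρ)
    (σ : H ⟶ F) (hσ : ρ ≫ σ = π) (hc : quotOf π hπ ⋖ quotOf ρ hρ) : IsSimpleEpi σ := by
  have hs : Epi σ := by
    have : Epi (ρ ≫ σ) := hσ ▸ hπ
    exact epi_of_epi ρ σ
  have e1 : (Subobject.map ρ.op).obj (quotOf σ hs) = quotOf π hπ := by
    subst hσ
    exact Subobject.map_mk _ _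
  have e2 : (Subobject.map ρ.op).obj ⊤ = quotOf ρ hρ := Subobject.map_top _
  refine ⟨hs, ?_, ?_⟩
  · intro hi
    have : quotOf σ hs = ⊤ := by
      unfold quotOf
      exact Subobject.mk_eq_top_of_isIso _
    rw [this, e2] at e1
    exact hc.lt.ne e1.symm
  · intro X hX
    have l1 : quotOf π hπ ≤ (Subobject.map ρ.op).obj X := by
      rw [← e1]; exact (Subobject.map ρ.op).monotone hX
    have l2 : (Subobject.map ρ.op).obj X ≤ quotOf ρ hρ := by
      rw [← e2]; exact (Subobject.map ρ.op).monotone le_top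
    rcases hc.eq_or_eq l1 l2 with h | h
    · left
      exact Subobject.map_obj_injective ρ.op (h.trans e1.symm)
    · right
      exact Subobject.map_obj_injective ρ.op (h.trans e2.symm)

theorem finite_dim (W : Set C) (hW : IsFormation W) (hWn : Narrow W) (d : ℕ) :
    ∀ F ∈ W, {X : IsoCls C | X.out ∈ W ∧
      ∃ (π : X.out ⟶ F) (h : Epi π), EpiDim π h d}.Finite := by
  induction d with
  | zero =>
    intro F hF
    refine (Set.finite_singleton (cls F)).subset ?_
    rintro X ⟨-, π, h, c, h0, h1, -⟩
    have ht : quotOf π h = ⊤ := h0.symm.trans h1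
    unfold quotOf at ht
    have : IsIso π.op := (Subobject.isIso_iff_mk_eq_top _).2 ht
    have : IsIso π := (isIso_op_iff π).1 this
    rw [Set.mem_singleton_iff, ← Quotient.out_eq X]
    exact Quotient.sound ⟨asIso π⟩
  | succ d ih =>
    intro F hF
    refine ((hWn F hF).biUnion (t := fun Y => {X : IsoCls C | X.out ∈ W ∧
      ∃ (π : X.out ⟶ Y.out) (h : Epi π), EpiDim π h d}) fun Y hY => ih _ hY.1).subset ?_
    rintro X ⟨hX, π, h, c, h0, h1, hc⟩
    obtain ⟨Y, ρ, hρ, e⟩ := exists_rep (c 1)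
    have hcov : quotOf π h ⋖ quotOf ρ hρ := by
      rw [e, ← h0]; exact hc 0
    obtain ⟨σ, hσ⟩ := exists_factor π h ρ hρ hcov.le
    refine Set.mem_biUnion (x := Y)
      ⟨hW.1 _ hX _ ρ hρ, σ, simple_of_covBy π h ρ hρ σ hσ hcov⟩ ?_
    exact ⟨hX, ρ, hρ, fun i => c i.succ, e.symm, h1, fun i => hc i.succ⟩

end MomentCat

open MomentCat in
/-- Lemma 2.6: for a narrow formation `W` in a diamond
category, `F ∈ W` and `d : ℕ`, there are only finitely many isomorphism classes
of objects `G ∈ W` admitting an epimorphism `G → F` of dimension `d`. -/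
theorem statement4 {C : Type u} [SmallCategory C] (hC : IsDiamond C)
    (W : Set C) (hW : IsFormation W) (hWn : Narrow W)
    (F : C) (hF : F ∈ W) (d : ℕ) :
    {X : IsoCls C | X.out ∈ W ∧ ∃ (π : X.out ⟶ F) (h : Epi π), EpiDim π h d}.Finite := by
  exact finite_dim W hW hWn d F hF
end
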